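/- (Sato divisor, Proposition of Malanyuk.) Let 1 ≤ k < n, κ_1 < … < κ_n real, c_1, …, c_n real, and A a totally nonnegative real k×n matrix of rank k. For every x ∈ ℝ, all complex roots of the Sato characteristic polynomial p(ζ, x) = ζ^k − Σ_{s=1}^k w_s(x) ζ^{k−s} are real and lie in the closed interval [κ_1, κ_n]. -/

import Mathlib

open scoped BigOperators

/-- The `k × k` maximal minor of a real `k × n` matrix `A` on the set of columns `I`
(defined to be `0` when `I` does not have exactly `k` elements). -/
noncomputable def maxMinor {k n : ℕ} (A : Matrix (Fin k) (Fin n) ℝ)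
    (I : Finset (Fin n)) : ℝ :=
  if h : I.card = k then
    (A.submatrix id fun j => ((I.orderIsoOfFin h) j : Fin n)).det
  else 0

section AlternatingSigns

lemma update_comp_of_injective {α β γ : Type*} [DecidableEq α] [DecidableEq β] {b : β → γ}
    {g : α → β} (hg : Function.Injective g) (i : α) (v : γ) :
    Function.update b (g i) v ∘ g = Function.update (b ∘ g) i v := by
  funext j
  by_cases hj : j = i
  · subst hj; simp
  · simp [Function.update_of_ne hj, Function.update_of_ne (hg.ne hj)]

lemma injective_of_map_ne_zero {k : ℕ} {ι W : Type*} [AddCommGroup W] [Module ℝ W]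
    {ω : W [⋀^Fin k]→ₗ[ℝ] ℝ} {b : ι → W} {g : Fin k → ι} (h : ω (b ∘ g) ≠ 0) :
    Function.Injective g := by
  intro i j hij
  by_contra hne
  exact h (ω.map_eq_zero_of_eq _ (by simp [hij] : (b ∘ g) i = (b ∘ g) j) hne)

variable {k : ℕ} {ι W : Type*} [LinearOrder ι] [AddCommGroup W] [Module ℝ W]

/-- `ω` is nonnegative on the vectors `b` listed along increasing `k`-tuples of indices in `S`,
and nonzero on some such tuple. -/
structure NonnegOn (ω : W [⋀^Fin k]→ₗ[ℝ] ℝ) (S : Finset ι) (b : ι → W) : Prop where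
  nonneg : ∀ g : Fin k → ι, StrictMono g → (∀ i, g i ∈ S) → 0 ≤ ω (b ∘ g)
  exists_pos : ∃ g : Fin k → ι, StrictMono g ∧ (∀ i, g i ∈ S) ∧ 0 < ω (b ∘ g)

/-- `a` and `c` are distinct neighbours in `S`, in either order. -/
structure AdjacentIn (S : Finset ι) (a c : ι) : Prop where
  left_mem : a ∈ S
  right_mem : c ∈ S
  ne : a ≠ c
  lt_iff : ∀ s ∈ S, s ≠ a → s ≠ c → (s < a ↔ s < c)

lemma AdjacentIn.symm {S : Finset ι} {a c : ι} (h : AdjacentIn S a c) : AdjacentIn S c a :=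
  ⟨h.right_mem, h.left_mem, h.ne.symm, fun s hs h₁ h₂ => (h.lt_iff s hs h₂ h₁).symm⟩

lemma AdjacentIn.strictMono_update {S : Finset ι} {a c : ι} (h : AdjacentIn S a c)
    {g : Fin k → ι} (hg : StrictMono g) (hS : ∀ i, g i ∈ S) {i : Fin k} (hi : g i = a)
    (hc : ∀ j, g j ≠ c) : StrictMono (Function.update g i c) := by
  have key : ∀ j, j ≠ i → (g j < a ↔ g j < c) := fun j hj =>
    h.lt_iff _ (hS j) (fun e => hj (hg.injective (e.trans hi.symm))) (hc j)
  intro x y hxy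
  by_cases hx : x = i
  · subst hx
    have hy : y ≠ x := hxy.ne'
    rw [Function.update_self, Function.update_of_ne hy]
    have := hg hxy
    rw [hi] at this
    exact lt_of_le_of_ne (not_lt.1 fun hlt => this.asymm ((key y hy).2 hlt)) (hc y).symm
  · by_cases hy : y = i
    · subst hy
      rw [Function.update_self, Function.update_of_ne hx]
      have := hg hxy
      rw [hi] at this
      exact (key x hx).1 this
    · rw [Function.update_of_ne hx, Function.update_of_ne hy]
      exact hg hxy

variable {ω : W [⋀^Fin k]→ₗ[ℝ] ℝ} {S : Finset ι} {b : ι → W}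

lemma exists_strictMono_pos
    (hpos : ∀ g : Fin k → ι, StrictMono g → (∀ i, g i ∈ S) → 0 ≤ ω (b ∘ g))
    {g : Fin k → ι} (hS : ∀ i, g i ∈ S) (hne : ω (b ∘ g) ≠ 0) :
    ∃ g' : Fin k → ι, StrictMono g' ∧ (∀ i, ∃ j, g' i = g j) ∧ 0 < ω (b ∘ g') := by
  have hinj := injective_of_map_ne_zero hne
  have hmono : StrictMono (g ∘ Tuple.sort g) :=
    (Tuple.monotone_sort g).strictMono_of_injective (hinj.comp (Tuple.sort g).injective)
  refine ⟨g ∘ Tuple.sort g, hmono, fun i => ⟨_, rfl⟩, lt_of_le_of_ne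
    (hpos _ hmono fun i => hS _) ?_⟩
  rw [← Function.comp_assoc, AlternatingMap.map_perm]
  rcases Int.units_eq_one_or (Equiv.Perm.sign (Tuple.sort g)) with h | h <;>
    simpa [h, eq_comm] using hne

/-- Adding a nonnegative multiple of a neighbouring vector does not decrease `ω`. -/
lemma AdjacentIn.le_map_update {a c : ι} (h : AdjacentIn S a c)
    (hpos : ∀ g : Fin k → ι, StrictMono g → (∀ i, g i ∈ S) → 0 ≤ ω (b ∘ g))
    {t : ℝ} (ht : 0 ≤ t) {g : Fin k → ι} (hg : StrictMono g) (hS : ∀ i, g i ∈ S) :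
    ω (b ∘ g) ≤ ω (Function.update b a (b a + t • b c) ∘ g) := by
  by_cases ha : ∃ i, g i = a
  · obtain ⟨i, rfl⟩ := ha
    rw [update_comp_of_injective hg.injective, ω.map_update_add, ω.map_update_smul]
    have h1 : Function.update (b ∘ g) i (b (g i)) = b ∘ g := Function.update_eq_self i (b ∘ g)
    rw [h1, smul_eq_mul]
    have h2 : Function.update (b ∘ g) i (b c) = b ∘ Function.update g i c := by
      rw [Function.comp_update]
    rw [h2]
    by_cases hc : ∃ j, g j = c
    · obtain ⟨j, rfl⟩ := hc
      have hij : j ≠ i := fun e => h.ne (by rw [e])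
      rw [ω.map_eq_zero_of_eq (b ∘ Function.update g i (g j)) (i := i) (j := j)
        (by simp [Function.update_of_ne hij]) hij.symm]
      simp
    · push Not at hc
      have := hpos _ (h.strictMono_update hg hS rfl hc) fun j => by
        by_cases hj : j = i
        · subst hj; simpa using h.right_mem
        · simpa [Function.update_of_ne hj] using hS j
      nlinarith [mul_nonneg ht this]
  · push Not at ha
    refine le_of_eq (congrArg ω ?_)
    funext j
    simp [Function.update_of_ne (ha j)]

lemma NonnegOn.update {a c : ι} (hb : NonnegOn ω S b) (h : AdjacentIn S a c)
    {t : ℝ} (ht : 0 ≤ t) : NonnegOn ω S (Function.update b a (b a + t • b c)) := by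
  obtain ⟨g, hg, hS, hlt⟩ := hb.exists_pos
  exact ⟨fun g hg hS => (hb.nonneg g hg hS).trans (h.le_map_update hb.nonneg ht hg hS),
    g, hg, hS, hlt.trans_le (h.le_map_update hb.nonneg ht hg hS)⟩

/-- A nontrivial linear relation forces more than `k` vectors. -/
lemma NonnegOn.lt_card {p : ι → ℝ} (hb : NonnegOn ω S b) (hp : ∑ s ∈ S, p s • b s = 0)
    (hne : ∃ s ∈ S, p s ≠ 0) : k < S.card := by
  obtain ⟨g, hg, hS, hlt⟩ := hb.exists_pos
  obtain ⟨s, hs, hps⟩ := hne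
  by_contra hcard
  have himg : Finset.univ.image g = S := by
    apply Finset.eq_of_subset_of_card_le
    · intro x hx
      obtain ⟨i, -, rfl⟩ := Finset.mem_image.1 hx
      exact hS i
    · rw [Finset.card_image_of_injective _ hg.injective]
      simpa using hcard
  obtain ⟨i, -, rfl⟩ := Finset.mem_image.1 (himg ▸ hs)
  have h0 : ω (Function.update (b ∘ g) i (∑ s ∈ S, p s • b s)) = 0 := by
    rw [hp]; exact ω.map_update_zero _ _
  rw [ω.map_update_sum, Finset.sum_eq_single_of_mem (g i) hs, ω.map_update_smul] at h0
  · have h1 : Function.update (b ∘ g) i (b (g i)) = b ∘ g := Function.update_eq_self i (b ∘ g)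
    rw [h1, smul_eq_mul] at h0
    exact (mul_ne_zero hps hlt.ne') h0
  · intro s hs hsi
    obtain ⟨j, -, rfl⟩ := Finset.mem_image.1 (himg ▸ hs)
    have hji : j ≠ i := fun e => hsi (by rw [e])
    rw [ω.map_update_smul, ω.map_eq_zero_of_eq _ (i := i) (j := j) _ hji.symm, smul_zero]
    simp [Function.update_of_ne hji]

/-- Two neighbouring vectors whose coefficients have the same sign can be merged. -/
lemma NonnegOn.merge {p : ι → ℝ} {a c : ι} (hb : NonnegOn ω S b) (h : AdjacentIn S a c)
    (hp : ∑ s ∈ S, p s • b s = 0) (ha : p a ≠ 0) (hac : 0 < p c / p a) :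
    NonnegOn ω (S.erase c) (Function.update b a (b a + (p c / p a) • b c)) ∧
      ∑ s ∈ S.erase c, p s • Function.update b a (b a + (p c / p a) • b c) s = 0 := by
  set b' := Function.update b a (b a + (p c / p a) • b c) with hb'
  have hN : NonnegOn ω S b' := hb.update h hac.le
  have haS : a ∈ S.erase c := Finset.mem_erase.2 ⟨h.ne, h.left_mem⟩
  have hoff : ∀ s, s ≠ a → b' s = b s := fun s hs => Function.update_of_ne hs _ _
  have hba : b' a = b a + (p c / p a) • b c := Function.update_self _ _ _
  have hrel : ∑ s ∈ S.erase c, p s • b' s = 0 := by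
    rw [← Finset.add_sum_erase _ _ haS]
    rw [← Finset.add_sum_erase _ _ h.right_mem, ← Finset.add_sum_erase _ _ haS] at hp
    rw [Finset.sum_congr rfl fun s hs => by rw [hoff s (Finset.ne_of_mem_erase hs)], hba, ← hp,
      smul_add, smul_smul, mul_div_cancel₀ _ ha]
    abel
  refine ⟨⟨fun g hg hS => hN.nonneg g hg fun i => Finset.mem_of_mem_erase (hS i), ?_⟩, hrel⟩
  -- a tuple containing `c` but not `a` can be moved from `c` to `a`
  have key : ∀ g : Fin k → ι, StrictMono g → (∀ i, g i ∈ S) → (∀ i, g i ≠ a) →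
      0 < ω (b' ∘ g) →
      ∃ g : Fin k → ι, StrictMono g ∧ (∀ i, g i ∈ S.erase c) ∧ 0 < ω (b' ∘ g) := by
    intro g hg hS hga hlt
    by_cases hc : ∃ i, g i = c
    · obtain ⟨i, hi⟩ := hc
      have hmono := h.symm.strictMono_update hg hS hi hga
      have hmem : ∀ j, Function.update g i a j ∈ S.erase c := fun j => by
        by_cases hj : j = i
        · subst hj; simpa using ⟨h.ne, h.left_mem⟩
        · rw [Function.update_of_ne hj]
          exact Finset.mem_erase.2 ⟨fun e => hj (hg.injective (e.trans hi.symm)), hS j⟩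
      refine ⟨_, hmono, hmem, ?_⟩
      have hbg : b' ∘ g = b ∘ g := funext fun j => hoff _ (hga j)
      have h0 := hb.nonneg _ hmono fun j => Finset.mem_of_mem_erase (hmem j)
      rw [Function.comp_update] at h0 ⊢
      have hcg : Function.update (b ∘ g) i (b c) = b ∘ g := by
        rw [← hi]; exact Function.update_eq_self i (b ∘ g)
      rw [hba, hbg, ω.map_update_add, ω.map_update_smul, hcg, smul_eq_mul, ← hbg]
      rw [← hbg] at h0
      exact add_pos_of_nonneg_of_pos h0 (mul_pos hac hlt)
    · push Not at hc
      exact ⟨g, hg, fun i => Finset.mem_erase.2 ⟨hc i, hS i⟩, hlt⟩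
  obtain ⟨g, hg, hS, hlt⟩ := hN.exists_pos
  by_cases hga : ∃ i, g i = a
  swap
  · push Not at hga
    exact key g hg hS hga hlt
  by_cases hgc : ∃ i, g i = c
  swap
  · push Not at hgc
    exact ⟨g, hg, fun i => Finset.mem_erase.2 ⟨hgc i, hS i⟩, hlt⟩
  -- both occur: use the relation to exchange `a` for another index
  obtain ⟨i, rfl⟩ := hga
  obtain ⟨j, rfl⟩ := hgc
  have h0 : ω (Function.update (b' ∘ g) i (∑ s ∈ S.erase (g j), p s • b' s)) = 0 := by
    rw [hrel]; exact ω.map_update_zero _ _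
  have hself : Function.update (b' ∘ g) i (b' (g i)) = b' ∘ g :=
    Function.update_eq_self i (b' ∘ g)
  rw [ω.map_update_sum, ← Finset.add_sum_erase _ _ haS, ω.map_update_smul, hself] at h0
  have hex : ∃ s ∈ (S.erase (g j)).erase (g i),
      ω (Function.update (b' ∘ g) i (p s • b' s)) ≠ 0 := by
    by_contra hall
    push Not at hall
    rw [Finset.sum_eq_zero hall, add_zero, smul_eq_mul] at h0
    exact (mul_ne_zero ha hlt.ne') h0
  obtain ⟨s, hs, hsne⟩ := hex
  rw [ω.map_update_smul, ← Function.comp_update] at hsne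
  have hsne' := right_ne_zero_of_smul hsne
  have hsi : s ≠ g i := Finset.ne_of_mem_erase hs
  have hsS : s ∈ S := Finset.mem_of_mem_erase (Finset.mem_of_mem_erase hs)
  have hmem : ∀ l, Function.update g i s l ∈ S := fun l => by
    by_cases hl : l = i
    · subst hl; simpa using hsS
    · simpa [Function.update_of_ne hl] using hS l
  obtain ⟨g', hg', hsub, hlt'⟩ := exists_strictMono_pos hN.nonneg hmem hsne'
  refine key g' hg' (fun l => ?_) (fun l => ?_) hlt'
  · obtain ⟨m, hm⟩ := hsub l
    exact hm ▸ hmem m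
  · obtain ⟨m, hm⟩ := hsub l
    rw [hm]
    by_cases hmi : m = i
    · subst hmi; simpa using hsi
    · rw [Function.update_of_ne hmi]
      exact hg.injective.ne hmi

/-- If consecutive values always have strictly opposite signs or vanish together, then a sequence
with a nonzero value alternates strictly. -/
lemma alternating_of_consecutive {m : ℕ} {q : ℕ → ℝ} (hne : ∃ i < m, q i ≠ 0)
    (h : ∀ i, i + 1 < m → (q i = 0 ∧ q (i + 1) = 0) ∨ q i * q (i + 1) < 0) :
    q 0 ≠ 0 ∧ ∀ i < m, 0 < q 0 * (-1) ^ i * q i := by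
  have hq0 : q 0 ≠ 0 := by
    intro h0
    obtain ⟨i, hi, hqi⟩ := hne
    refine hqi ?_
    clear hqi
    induction i with
    | zero => exact h0
    | succ i ih =>
      rcases h i hi with h1 | h1
      · exact h1.2
      · rw [ih (by omega)] at h1
        simp at h1
  refine ⟨hq0, fun i => ?_⟩
  induction i with
  | zero => intro _; simpa using hq0
  | succ i ih =>
    intro hi
    have hi' := ih (by omega)
    rcases h i hi with h1 | h1
    · rw [h1.1] at hi'; simp at hi'
    · have h2 : (q 0 * (-1) ^ (i + 1) * q (i + 1)) * (q i * q i)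
          = (q 0 * (-1) ^ i * q i) * (-(q i * q (i + 1))) := by ring
      have h3 : 0 < q i * q i := mul_self_pos.2 fun e => by rw [e] at hi'; simp at hi'
      exact pos_of_mul_pos_left (h2 ▸ mul_pos hi' (neg_pos.2 h1)) h3.le

/-- Gantmacher–Krein: a nontrivial relation among vectors on which an alternating `k`-form is
nonnegative has coefficients alternating weakly in sign at some `k + 1` indices. -/
theorem NonnegOn.exists_alternating {p : ι → ℝ} (hb : NonnegOn ω S b)
    (hp : ∑ s ∈ S, p s • b s = 0) (hne : ∃ s ∈ S, p s ≠ 0) :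
    ∃ h : Fin (k + 1) → ι, StrictMono h ∧ (∀ i, h i ∈ S) ∧
      ∃ ε : ℝ, ε ≠ 0 ∧ ∀ i : Fin (k + 1), 0 ≤ ε * (-1) ^ (i : ℕ) * p (h i) := by
  induction hm : S.card + (S.filter fun s => p s = 0).card using Nat.strong_induction_on
    generalizing S b p with
  | _ m ih =>
  subst hm
  by_cases hadj : ∃ a c, AdjacentIn S a c ∧ p a ≠ 0 ∧ 0 ≤ p c / p a
  · obtain ⟨a, c, hac, ha, hq⟩ := hadj
    rcases hq.eq_or_lt with hq | hq
    · have hc : p c = 0 := by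
        rcases div_eq_zero_iff.1 hq.symm with h | h
        · exact h
        · exact absurd h ha
      have haS : a ∈ S.erase c := Finset.mem_erase.2 ⟨hac.ne, hac.left_mem⟩
      have hrel : ∑ s ∈ S, Function.update p c (-p a) s •
          Function.update b a (b a + (1 : ℝ) • b c) s = 0 := by
        rw [← Finset.add_sum_erase _ _ hac.right_mem, ← Finset.add_sum_erase _ _ haS] at hp ⊢
        rw [Finset.sum_congr rfl fun s hs => by
          rw [Function.update_of_ne (Finset.ne_of_mem_erase hs),
            Function.update_of_ne (Finset.ne_of_mem_erase (Finset.mem_of_mem_erase hs))],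
          ← hp, Function.update_self, Function.update_self, Function.update_of_ne hac.ne,
          Function.update_of_ne hac.ne.symm, hc]
        module
      have hlt : S.card + (S.filter fun s => Function.update p c (-p a) s = 0).card <
          S.card + (S.filter fun s => p s = 0).card := by
        refine Nat.add_lt_add_left (Finset.card_lt_card ?_) _
        refine Finset.ssubset_iff_of_subset ?_ |>.2
          ⟨c, by simp [hc, hac.right_mem], by simp [ha]⟩
        intro s hs
        rw [Finset.mem_filter] at hs ⊢
        refine ⟨hs.1, ?_⟩
        by_cases hsc : s = c
        · rw [hsc, hc]
        · rw [← hs.2, Function.update_of_ne hsc]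
      obtain ⟨h, hmono, hS, ε, hε, halt⟩ := ih _ hlt (hb.update hac zero_le_one) hrel
        ⟨a, hac.left_mem, by rwa [Function.update_of_ne hac.ne]⟩ rfl
      refine ⟨h, hmono, hS, ε, hε, fun i => ?_⟩
      by_cases hi : h i = c
      · rw [hi, hc, mul_zero]
      · simpa [Function.update_of_ne hi] using halt i
    · obtain ⟨hN, hrel⟩ := hb.merge hac hp ha hq
      have hlt : (S.erase c).card + ((S.erase c).filter fun s => p s = 0).card <
          S.card + (S.filter fun s => p s = 0).card :=
        Nat.add_lt_add_of_lt_of_le (Finset.card_erase_lt_of_mem hac.right_mem)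
          (Finset.card_le_card (Finset.filter_subset_filter _ (Finset.erase_subset _ _)))
      obtain ⟨h, hmono, hS, ε, hε, halt⟩ := ih _ hlt hN hrel
        ⟨a, Finset.mem_erase.2 ⟨hac.ne, hac.left_mem⟩, ha⟩ rfl
      exact ⟨h, hmono, fun i => Finset.mem_of_mem_erase (hS i), ε, hε, halt⟩
  · push Not at hadj
    have hk := hb.lt_card hp hne
    let e := S.orderEmbOfFin rfl
    let q : ℕ → ℝ := fun i => if hi : i < S.card then p (e ⟨i, hi⟩) else 0
    have hadj' : ∀ i (hi : i + 1 < S.card),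
        AdjacentIn S (e ⟨i, by omega⟩) (e ⟨i + 1, hi⟩) := by
      intro i hi
      refine ⟨S.orderEmbOfFin_mem rfl _, S.orderEmbOfFin_mem rfl _, fun h => ?_, ?_⟩
      · have := congrArg Fin.val (e.injective h)
        simp at this
      · intro s hs h1 h2
        obtain ⟨l, rfl⟩ : ∃ l, e l = s := by
          have : s ∈ Set.range e := by rw [Finset.range_orderEmbOfFin]; exact hs
          exact this
        rw [e.lt_iff_lt, e.lt_iff_lt, Fin.lt_def, Fin.lt_def]
        have h1' : (l : ℕ) ≠ i := fun h => h1 (congrArg e (Fin.ext h))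
        have h2' : (l : ℕ) ≠ i + 1 := fun h => h2 (congrArg e (Fin.ext h))
        simp only
        omega
    have hcons : ∀ i, i + 1 < S.card →
        (q i = 0 ∧ q (i + 1) = 0) ∨ q i * q (i + 1) < 0 := by
      intro i hi
      have hA := hadj' i hi
      have hqi : q i = p (e ⟨i, by omega⟩) := dif_pos _
      have hqi' : q (i + 1) = p (e ⟨i + 1, hi⟩) := dif_pos _
      have l := hadj _ _ hA
      have r := hadj _ _ hA.symm
      rw [← hqi, ← hqi'] at l r
      by_cases h0 : q i = 0
      · by_cases h1 : q (i + 1) = 0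
        · exact Or.inl ⟨h0, h1⟩
        · have := r h1
          simp [h0] at this
      · refine Or.inr ?_
        have h3 : q i * q (i + 1) = (q (i + 1) / q i) * (q i * q i) := by field_simp
        rw [h3]
        exact mul_neg_of_neg_of_pos (l h0) (mul_self_pos.2 h0)
    have hqne : ∃ i < S.card, q i ≠ 0 := by
      obtain ⟨s, hs, hps⟩ := hne
      obtain ⟨l, rfl⟩ : ∃ l, e l = s := by
        have : s ∈ Set.range e := by rw [Finset.range_orderEmbOfFin]; exact hs
        exact this
      exact ⟨l, l.2, by simpa [q] using hps⟩
    obtain ⟨hq0, halt⟩ := alternating_of_consecutive hqne hcons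
    refine ⟨fun i => e ⟨i, by omega⟩, fun i j hij => e.strictMono (by simpa using hij),
      fun i => S.orderEmbOfFin_mem rfl _, q 0, hq0, fun i => ?_⟩
    have hi : (i : ℕ) < S.card := by omega
    have := halt i hi
    simp only [q, dif_pos hi] at this
    exact this.le

end AlternatingSigns

section WeaklyAlternating

open Polynomial

/-- The barycentric weights of an increasing sequence of nodes alternate in sign. -/
lemma nodalWeight_sign {k : ℕ} {t : Fin (k + 1) → ℝ} (ht : StrictMono t) (i : Fin (k + 1)) :
    0 < (-1) ^ (k - (i : ℕ)) * Lagrange.nodalWeight Finset.univ t i := by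
  have hsplit : (Finset.univ.erase i : Finset (Fin (k + 1))) = Finset.Iio i ∪ Finset.Ioi i := by
    ext j; simp
  have hdisj : Disjoint (Finset.Iio i) (Finset.Ioi i) :=
    Finset.disjoint_left.2 fun j h1 h2 => lt_asymm (Finset.mem_Iio.1 h1) (Finset.mem_Ioi.1 h2)
  have hcard : (Finset.Ioi i).card = k - (i : ℕ) := by simp
  rw [Lagrange.nodalWeight, hsplit, Finset.prod_union hdisj, mul_left_comm, ← hcard,
    ← Finset.prod_const, ← Finset.prod_mul_distrib]
  refine mul_pos (Finset.prod_pos fun j hj => ?_) (Finset.prod_pos fun j hj => ?_)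
  · exact inv_pos.2 (sub_pos.2 (ht (Finset.mem_Iio.1 hj)))
  · have := ht (Finset.mem_Ioi.1 hj)
    rw [neg_one_mul, ← inv_neg]
    exact inv_pos.2 (by linarith)

/-- A nonnegative combination of simple fractions with real poles has only real zeros, lying in the
interval spanned by the poles. -/
lemma zero_of_sum_simple_fractions {k : ℕ} {t : Fin (k + 1) → ℝ} (ht : StrictMono t)
    {d : Fin (k + 1) → ℝ} (hd : ∀ i, 0 ≤ d i) (hne : ∃ i, d i ≠ 0) {z : ℂ}
    (hzt : ∀ i, z ≠ t i) (hz : ∑ i, (d i : ℂ) * (z - t i)⁻¹ = 0) :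
    z.im = 0 ∧ t 0 ≤ z.re ∧ z.re ≤ t (Fin.last k) := by
  set e : Fin (k + 1) → ℝ := fun i => d i * (Complex.normSq (z - t i))⁻¹ with he
  have hq : ∀ i, 0 < (Complex.normSq (z - t i))⁻¹ := fun i =>
    inv_pos.2 (Complex.normSq_pos.2 (sub_ne_zero.2 (hzt i)))
  have he0 : ∀ i, 0 ≤ e i := fun i => mul_nonneg (hd i) (hq i).le
  have hsum : 0 < ∑ i, e i := by
    obtain ⟨i, hi⟩ := hne
    exact Finset.sum_pos' (fun i _ => he0 i)
      ⟨i, Finset.mem_univ _, mul_pos (lt_of_le_of_ne (hd i) hi.symm) (hq i)⟩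
  have hre : ∑ i, e i * (z.re - t i) = 0 := by
    have := congrArg Complex.re hz
    rw [Complex.re_sum, Complex.zero_re] at this
    rw [← this]
    refine Finset.sum_congr rfl fun i _ => ?_
    rw [Complex.re_ofReal_mul, Complex.inv_re, Complex.sub_re, Complex.ofReal_re, he]
    ring
  have him : (∑ i, e i) * z.im = 0 := by
    have := congrArg Complex.im hz
    rw [Complex.im_sum, Complex.zero_im] at this
    rw [← neg_eq_zero, ← this, Finset.sum_mul, ← Finset.sum_neg_distrib]
    refine Finset.sum_congr rfl fun i _ => ?_
    rw [Complex.im_ofReal_mul, Complex.inv_im, Complex.sub_im, Complex.ofReal_im, he]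
    ring
  have hre' : ∑ i, e i * t i = (∑ i, e i) * z.re := by
    rw [Finset.sum_mul, eq_comm, ← sub_eq_zero, ← Finset.sum_sub_distrib, ← hre]
    exact Finset.sum_congr rfl fun i _ => by ring
  refine ⟨(mul_eq_zero.1 him).resolve_left hsum.ne', ?_, ?_⟩
  · refine le_of_mul_le_mul_left ?_ hsum
    rw [← hre', Finset.sum_mul]
    exact Finset.sum_le_sum fun i _ =>
      mul_le_mul_of_nonneg_left (ht.monotone (Fin.zero_le i)) (he0 i)
  · refine le_of_mul_le_mul_left ?_ hsum
    rw [← hre', Finset.sum_mul]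
    exact Finset.sum_le_sum fun i _ =>
      mul_le_mul_of_nonneg_left (ht.monotone (Fin.le_last i)) (he0 i)

/-- A nonzero real polynomial of degree at most `k` whose values alternate weakly in sign at `k + 1`
increasing points has only real roots, all between the extreme points. -/
theorem root_of_weakly_alternating {k : ℕ} {t : Fin (k + 1) → ℝ} (ht : StrictMono t)
    {P : ℝ[X]} (hP : P ≠ 0) (hdeg : P.natDegree ≤ k) {ε : ℝ} (hε : ε ≠ 0)
    (halt : ∀ i : Fin (k + 1), 0 ≤ ε * (-1) ^ (i : ℕ) * P.eval (t i)) {z : ℂ} (hz : aeval z P = 0) :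
    z.im = 0 ∧ t 0 ≤ z.re ∧ z.re ≤ t (Fin.last k) := by
  by_cases hzt : ∃ i, z = t i
  · obtain ⟨i, rfl⟩ := hzt
    exact ⟨Complex.ofReal_im _, by simpa using ht.monotone (Fin.zero_le i),
      by simpa using ht.monotone (Fin.le_last i)⟩
  push Not at hzt
  let v : Fin (k + 1) → ℂ := fun i => t i
  have hv : Function.Injective v := Complex.ofReal_injective.comp ht.injective
  have hinterp := Lagrange.eq_interpolate (f := P.map (algebraMap ℝ ℂ)) (s := Finset.univ) (v := v)
    hv.injOn (by
      rw [degree_map, Finset.card_univ, Fintype.card_fin]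
      exact (degree_le_natDegree).trans_lt (by exact_mod_cast Nat.lt_succ_of_le hdeg))
  rw [← eval_map_algebraMap, hinterp, Lagrange.eval_interpolate_not_at_node _ fun i _ => hzt i]
    at hz
  have hz' := (mul_eq_zero.1 hz).resolve_left
    (Lagrange.eval_nodal_not_at_node fun i _ => hzt i)
  have hweight : ∀ i, Lagrange.nodalWeight Finset.univ v i
      = ((Lagrange.nodalWeight Finset.univ t i : ℝ) : ℂ) := fun i => by
    simp [Lagrange.nodalWeight, v]
  have heval : ∀ i, (P.map (algebraMap ℝ ℂ)).eval (v i) = ((P.eval (t i) : ℝ) : ℂ) := fun i => by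
    rw [eval_map_algebraMap]
    exact aeval_algebraMap_apply_eq_algebraMap_eval _ _
  refine zero_of_sum_simple_fractions ht
    (d := fun i => (ε * (-1) ^ k) * (Lagrange.nodalWeight Finset.univ t i * P.eval (t i)))
    (fun i => ?_) ?_ hzt ?_
  · have := mul_nonneg (nodalWeight_sign ht i).le (halt i)
    refine this.trans_eq ?_
    have hpow : (-1 : ℝ) ^ k = (-1) ^ (k - (i : ℕ)) * (-1) ^ (i : ℕ) := by
      rw [← pow_add, Nat.sub_add_cancel (by omega)]
    rw [hpow]
    ring
  · by_contra hall
    push Not at hall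
    refine hP (eq_zero_of_natDegree_lt_card_of_eval_eq_zero P ht.injective (fun i => ?_)
      (by simpa using Nat.lt_succ_of_le hdeg))
    have hw := right_ne_zero_of_mul (nodalWeight_sign ht i).ne'
    have hε' : ε * (-1) ^ k ≠ 0 := mul_ne_zero hε (pow_ne_zero _ (by norm_num))
    exact (mul_eq_zero.1 ((mul_eq_zero.1 (hall i)).resolve_left hε')).resolve_left hw
  · rw [← mul_zero ((ε * (-1) ^ k : ℝ) : ℂ), ← hz', Finset.mul_sum]
    refine Finset.sum_congr rfl fun i _ => ?_
    rw [hweight, heval]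
    push_cast
    ring

end WeaklyAlternating

/-- Matrices of full row rank have a nonzero maximal minor. -/
lemma exists_det_submatrix_ne_zero {k n : ℕ} {A : Matrix (Fin k) (Fin n) ℝ} (hA : A.rank = k) :
    ∃ g : Fin k → Fin n, (A.submatrix id g).det ≠ 0 := by
  rw [Matrix.rank_eq_finrank_span_cols] at hA
  obtain ⟨f, hf, hli⟩ : ∃ f : Fin k → Fin k → ℝ, (∀ i, f i ∈ Set.range A.col) ∧
      LinearIndependent ℝ f := by
    have h := Submodule.exists_fun_fin_finrank_span_eq ℝ (Set.range A.col)
    rw [hA] at h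
    exact h.imp fun f hf => ⟨hf.1, hf.2.2⟩
  choose g hg using hf
  refine ⟨g, ?_⟩
  have hrow : (A.submatrix id g).transpose.row = f := funext hg
  rw [← Matrix.det_transpose, ← isUnit_iff_ne_zero, ← Matrix.isUnit_iff_isUnit_det,
    ← Matrix.linearIndependent_rows_iff_isUnit, hrow]
  exact hli

lemma maxMinor_image {k n : ℕ} (A : Matrix (Fin k) (Fin n) ℝ) {g : Fin k → Fin n}
    (hg : StrictMono g) : maxMinor A (Finset.univ.image g) = (A.submatrix id g).det := by
  have hcard : (Finset.univ.image g).card = k := by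
    rw [Finset.card_image_of_injective _ hg.injective, Finset.card_univ, Fintype.card_fin]
  have hg' : g = (Finset.univ.image g).orderEmbOfFin hcard :=
    Finset.orderEmbOfFin_unique hcard (fun i => Finset.mem_image_of_mem g (Finset.mem_univ i)) hg
  rw [maxMinor, dif_pos hcard]
  conv_rhs => rw [hg']
  rfl

/-- The columns of a totally nonnegative matrix of full rank, tested against the determinant. -/
lemma nonnegOn_col {k n : ℕ} {A : Matrix (Fin k) (Fin n) ℝ} (hA : A.rank = k)
    (hTNN : ∀ I : Finset (Fin n), I.card = k → 0 ≤ maxMinor A I) :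
    NonnegOn (Matrix.detRowAlternating (n := Fin k) (R := ℝ)) Finset.univ A.col := by
  have hdet : ∀ g : Fin k → Fin n,
      Matrix.detRowAlternating (A.col ∘ g) = (A.submatrix id g).det := fun g =>
    Matrix.det_transpose (A.submatrix id g)
  have hnonneg : ∀ g : Fin k → Fin n, StrictMono g → (∀ i, g i ∈ Finset.univ) →
      0 ≤ Matrix.detRowAlternating (A.col ∘ g) := fun g hg _ => by
    rw [hdet, ← maxMinor_image A hg]
    refine hTNN _ ?_
    rw [Finset.card_image_of_injective _ hg.injective, Finset.card_univ, Fintype.card_fin]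
  obtain ⟨g, hg⟩ := exists_det_submatrix_ne_zero hA
  obtain ⟨g', hmono, -, hpos⟩ :=
    exists_strictMono_pos hnonneg (fun i => Finset.mem_univ (g i)) (by rwa [hdet])
  exact ⟨hnonneg, g', hmono, fun _ => Finset.mem_univ _, hpos⟩

lemma iteratedDeriv_sum_exp {ι : Type*} [Fintype ι] (a κ c : ι → ℝ) (m : ℕ) :
    iteratedDeriv m (fun x => ∑ j, a j * Real.exp (κ j * x + c j)) =
      fun x => ∑ j, a j * Real.exp (κ j * x + c j) * κ j ^ m := by
  induction m with
  | zero => simp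
  | succ m ih =>
    rw [iteratedDeriv_succ, ih]
    funext x
    refine HasDerivAt.deriv (HasDerivAt.fun_sum fun j _ => ?_)
    have h := ((((hasDerivAt_id x).const_mul (κ j)).add_const (c j)).exp.const_mul
      (a j)).mul_const (κ j ^ m)
    refine h.congr_deriv ?_
    simp only [id]
    ring

/-- The real polynomial `ζ^k - Σ_s u_s ζ^{k-1-s}`. -/
noncomputable def satoPoly {k : ℕ} (u : Fin k → ℝ) : Polynomial ℝ :=
  Polynomial.X ^ k - ∑ s : Fin k, Polynomial.C (u s) * Polynomial.X ^ (k - 1 - (s : ℕ))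

lemma degree_satoPoly_sum_lt {k : ℕ} (u : Fin k → ℝ) :
    (∑ s : Fin k, Polynomial.C (u s) * (Polynomial.X : Polynomial ℝ) ^ (k - 1 - (s : ℕ))).degree <
      (k : WithBot ℕ) := by
  refine (Polynomial.degree_sum_le _ _).trans_lt ((Finset.sup_lt_iff (WithBot.bot_lt_coe k)).2
    fun s _ => (Polynomial.degree_C_mul_X_pow_le _ _).trans_lt ?_)
  have := s.2
  exact WithBot.coe_lt_coe.2 (by omega : k - 1 - (s : ℕ) < k)

lemma monic_satoPoly {k : ℕ} (u : Fin k → ℝ) : (satoPoly u).Monic :=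
  Polynomial.monic_X_pow_sub (degree_satoPoly_sum_lt u)

lemma natDegree_satoPoly {k : ℕ} (u : Fin k → ℝ) : (satoPoly u).natDegree = k := by
  refine Polynomial.natDegree_eq_of_degree_eq_some ?_
  rw [satoPoly, Polynomial.degree_sub_eq_left_of_degree_lt] <;>
    rw [Polynomial.degree_X_pow]
  exact degree_satoPoly_sum_lt u

/-- Sato divisor, Malanyuk: for TNN soliton data with Darboux
coefficients `w`, for every `x` all complex roots of the Sato characteristic
polynomial `p(ζ,x) = ζ^k - Σ_s w_s(x) ζ^{k-s}` are real and lie in `[κ_1, κ_n]`. -/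
theorem sato_divisor_real_and_bounded
    (k n : ℕ) (hk : 1 ≤ k) (hkn : k < n)
    (κ c : Fin n → ℝ) (hκ : StrictMono κ)
    (A : Matrix (Fin k) (Fin n) ℝ) (hrank : A.rank = k)
    (hTNN : ∀ I : Finset (Fin n), I.card = k → 0 ≤ maxMinor A I)
    (f : Fin k → ℝ → ℝ)
    (hf : ∀ i x, f i x = ∑ j, A i j * Real.exp (κ j * x + c j))
    (w : Fin k → ℝ → ℝ)
    (hw : ∀ x i, iteratedDeriv k (f i) x =
      ∑ s : Fin k, w s x * iteratedDeriv (k - 1 - (s : ℕ)) (f i) x)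
    (x : ℝ) (z : ℂ)
    (hz : z ^ k - ∑ s : Fin k, (w s x : ℂ) * z ^ (k - 1 - (s : ℕ)) = 0) :
    z.im = 0 ∧ κ ⟨0, by omega⟩ ≤ z.re ∧ z.re ≤ κ ⟨n - 1, by omega⟩ := by
  set P := satoPoly fun s => w s x with hPdef
  have hP : P ≠ 0 := (monic_satoPoly _).ne_zero
  have hdeg : P.natDegree = k := natDegree_satoPoly _
  have hderiv : ∀ m i, iteratedDeriv m (f i) x =
      ∑ j, A i j * Real.exp (κ j * x + c j) * κ j ^ m := fun m i => by
    rw [funext (hf i), iteratedDeriv_sum_exp]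
  have hrel : ∑ j, (Real.exp (κ j * x + c j) * P.eval (κ j)) • A.col j = 0 := by
    funext i
    have h := hw x i
    simp only [hderiv, Finset.mul_sum] at h
    rw [Finset.sum_comm, ← sub_eq_zero, ← Finset.sum_sub_distrib] at h
    rw [Finset.sum_apply, Pi.zero_apply, ← h]
    refine Finset.sum_congr rfl fun j _ => ?_
    simp only [Pi.smul_apply, smul_eq_mul, Matrix.col_apply, hPdef, satoPoly,
      Polynomial.eval_sub, Polynomial.eval_pow, Polynomial.eval_X, Polynomial.eval_finsetSum,
      Polynomial.eval_mul, Polynomial.eval_C, mul_sub, sub_mul, Finset.mul_sum, Finset.sum_mul]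
    congr 1
    · ring
    · exact Finset.sum_congr rfl fun s _ => by ring
  have hne : ∃ j ∈ Finset.univ, Real.exp (κ j * x + c j) * P.eval (κ j) ≠ 0 := by
    by_contra hall
    push Not at hall
    refine hP (Polynomial.eq_zero_of_natDegree_lt_card_of_eval_eq_zero P hκ.injective (fun j => ?_)
      (by rw [hdeg, Fintype.card_fin]; exact hkn))
    exact (mul_eq_zero.1 (hall j (Finset.mem_univ j))).resolve_left (Real.exp_ne_zero _)
  obtain ⟨h, hmono, -, ε, hε, halt⟩ := (nonnegOn_col hrank hTNN).exists_alternating hrel hne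
  have hroot : Polynomial.aeval z P = 0 := by
    simpa [hPdef, satoPoly] using hz
  obtain ⟨him, hlo, hhi⟩ := root_of_weakly_alternating (hκ.comp hmono) hP hdeg.le hε
    (fun i => nonneg_of_mul_nonneg_right
      ((halt i).trans_eq (by simp only [Function.comp]; ring)) (Real.exp_pos (κ (h i) * x + c (h i))))
    hroot
  refine ⟨him, le_trans (hκ.monotone ?_) hlo, hhi.trans (hκ.monotone ?_)⟩
  · exact Fin.le_def.2 (Nat.zero_le _)
  · exact Fin.le_def.2 (Nat.le_sub_one_of_lt (h _).2)
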